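/- Let Σ be an immersed minimal disk in the Euclidean unit ball B^3 whose boundary lies on ∂B^3 and which meets ∂B^3 orthogonally along its boundary. Then Σ is a totally geodesic (flat) equatorial disk through the center of the ball. -/

import Mathlib

/-!
# STATEMENT 2 (Nitsche 1985)

An immersed minimal disk in the closed Euclidean unit ball `B³` whose boundary
lies on `∂B³` and which meets `∂B³` orthogonally along its boundary is a totally
geodesic (flat) equatorial disk through the center of the ball.

Modelling: the disk is given by a conformally parametrized immersion
`u : D² → ℝ³` defined on the closed unit disk, smooth up to the boundary.
Minimality is expressed by the classical fact that a conformal harmonic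
immersion is exactly a conformally parametrized minimal surface.  Properness of
the boundary and the free boundary (orthogonality) condition are expressed
through `u`:  `u` maps `∂D²` exactly onto the part of the surface in `∂B³`, and
along `∂D²` the outward normal derivative of `u` is parallel to the position
vector (this is the orthogonal meeting condition).  The conclusion is that the
image is `B³ ∩ P` for a 2-dimensional linear subspace `P ⊆ ℝ³`.
-/

noncomputable section
open Metric Set
open scoped RealInnerProductSpace

theorem minor_eq_zero_of_isotropic {a b : Fin 3 → ℂ} (haa : ∑ i, a i ^ 2 = 0)
    (hab : ∑ i, a i * b i = 0) (hbb : ∑ i, b i ^ 2 = 0) (i j : Fin 3) :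
    a i * b j = a j * b i := by
  simp only [Fin.sum_univ_three] at haa hab hbb
  have h01 : (a 0 * b 1 - a 1 * b 0) ^ 2 = 0 := by
    linear_combination (b 0 ^ 2 + b 1 ^ 2) * haa - a 2 ^ 2 * hbb +
      (2 * a 2 * b 2 - (a 0 * b 0 + a 1 * b 1 + a 2 * b 2)) * hab
  have h02 : (a 0 * b 2 - a 2 * b 0) ^ 2 = 0 := by
    linear_combination (b 0 ^ 2 + b 2 ^ 2) * haa - a 1 ^ 2 * hbb +
      (2 * a 1 * b 1 - (a 0 * b 0 + a 1 * b 1 + a 2 * b 2)) * hab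
  have h12 : (a 1 * b 2 - a 2 * b 1) ^ 2 = 0 := by
    linear_combination (b 1 ^ 2 + b 2 ^ 2) * haa - a 0 ^ 2 * hbb +
      (2 * a 0 * b 0 - (a 0 * b 0 + a 1 * b 1 + a 2 * b 2)) * hab
  have h01 := sub_eq_zero.1 (pow_eq_zero_iff two_ne_zero |>.1 h01)
  have h02 := sub_eq_zero.1 (pow_eq_zero_iff two_ne_zero |>.1 h02)
  have h12 := sub_eq_zero.1 (pow_eq_zero_iff two_ne_zero |>.1 h12)
  fin_cases i <;> fin_cases j <;> simp <;> first | assumption | exact Eq.symm ‹_›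

theorem eq_of_im_eq_zero_on_sphere {G : ℂ → ℂ} (hc : ContinuousOn G (closedBall 0 1))
    (hd : DifferentiableOn ℂ G (ball 0 1)) (him : ∀ z ∈ sphere (0 : ℂ) 1, (G z).im = 0)
    {z : ℂ} (hz : z ∈ ball (0 : ℂ) 1) : G z = G 0 := by
  have key : ∀ s : ℂ, s.re = 0 → ∀ z ∈ ball (0 : ℂ) 1, s.im * (G z).im ≥ 0 := by
    intro s hs z hz
    have hcl : closure (ball (0 : ℂ) 1) = closedBall 0 1 := closure_ball 0 one_ne_zero
    have hE : DiffContOnCl ℂ (fun z => Complex.exp (s * G z)) (ball 0 1) :=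
      ⟨(hd.const_mul s).cexp, by rw [hcl]; exact (continuousOn_const.mul hc).cexp⟩
    have := Complex.norm_le_of_forall_mem_frontier_norm_le isBounded_ball hE (C := 1) (z := z)
      (by
        intro y hy
        rw [frontier_ball 0 one_ne_zero] at hy
        simp [Complex.norm_exp, hs, him y hy]) (subset_closure hz)
    rw [Complex.norm_exp, Real.exp_le_one_iff] at this
    simp [hs] at this
    linarith
  have him0 : ∀ z ∈ ball (0 : ℂ) 1, (G z).im = 0 := by
    intro z hz
    have h1 := key Complex.I (by simp) z hz
    have h2 := key (-Complex.I) (by simp) z hz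
    simp at h1 h2
    linarith
  obtain ⟨c, hcc⟩ := (hd.analyticOnNhd isOpen_ball).eq_const_of_im_eq_const him0 isOpen_ball
    ((convex_ball _ _).isConnected ⟨0, by simp⟩)
  rw [hcc z hz, hcc 0 (by simp)]

theorem mul_eq_mul_of_wronskian_eq_zero {f g : ℂ → ℂ} (hf : DifferentiableOn ℂ f (ball 0 1))
    (hg : DifferentiableOn ℂ g (ball 0 1))
    (hw : ∀ z ∈ ball (0 : ℂ) 1, f z * deriv g z = g z * deriv f z) (h0 : f 0 ≠ 0)
    {z : ℂ} (hz : z ∈ ball (0 : ℂ) 1) : g z * f 0 = f z * g 0 := by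
  have hU : IsOpen (ball (0 : ℂ) 1) := isOpen_ball
  have hne : ∀ᶠ z in nhds (0 : ℂ), f z ≠ 0 ∧ z ∈ ball (0 : ℂ) 1 :=
    ((hf.differentiableAt (hU.mem_nhds (by simp))).continuousAt.eventually_ne h0).and
      (hU.mem_nhds (by simp))
  obtain ⟨r, hr, hsub⟩ := Metric.eventually_nhds_iff_ball.1 hne
  have hquot : ∀ y ∈ ball (0 : ℂ) r, g y / f y = g 0 / f 0 := by
    intro y hy
    refine isOpen_ball.is_const_of_deriv_eq_zero (𝕜 := ℂ) (convex_ball 0 r).isPreconnected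
      (f := fun y => g y / f y) (fun x hx => ?_) (fun x hx => ?_) hy (by simpa using hr)
    · exact (((hg.differentiableAt (hU.mem_nhds (hsub x hx).2)).div
        (hf.differentiableAt (hU.mem_nhds (hsub x hx).2)) (hsub x hx).1)).differentiableWithinAt
    · have hgx := hg.differentiableAt (hU.mem_nhds (hsub x hx).2)
      have hfx := hf.differentiableAt (hU.mem_nhds (hsub x hx).2)
      rw [show (fun y => g y / f y) = g / f from rfl, deriv_div hgx hfx (hsub x hx).1]
      have := hw x (hsub x hx).2
      simp only [Pi.zero_apply, div_eq_zero_iff]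
      left
      linear_combination this
  refine AnalyticOnNhd.eqOn_of_preconnected_of_eventuallyEq (z₀ := 0) (U := ball (0 : ℂ) 1)
    (f := fun z => g z * f 0) (g := fun z => f z * g 0)
    ((hg.mul_const _).analyticOnNhd hU) ((hf.mul_const _).analyticOnNhd hU)
    (convex_ball _ _).isPreconnected (by simp) ?_ hz
  filter_upwards [ball_mem_nhds (0 : ℂ) hr] with y hy
  have h1 := hquot y hy
  rw [div_eq_div_iff (hsub y hy).1 h0] at h1
  linear_combination h1

theorem closedBall_subset_image_of_proper {h : ℂ → ℂ} (hc : ContinuousOn h (closedBall 0 1))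
    (hd : DifferentiableOn ℂ h (ball 0 1)) (hlt : ∀ z ∈ ball (0 : ℂ) 1, ‖h z‖ < 1)
    (heq : ∀ z ∈ sphere (0 : ℂ) 1, ‖h z‖ = 1) :
    closedBall 0 1 ⊆ h '' closedBall 0 1 := by
  have hcl : closure (ball (0 : ℂ) 1) = closedBall 0 1 := closure_ball 0 one_ne_zero
  have hcomp : IsCompact (h '' closedBall 0 1) := (isCompact_closedBall 0 1).image_of_continuousOn hc
  have hopen : IsOpen (h '' ball 0 1) := by
    rcases (hd.analyticOnNhd isOpen_ball).is_constant_or_isOpen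
      (convex_ball _ _).isPreconnected with ⟨w, hw⟩ | H
    · exfalso
      have h1 : EqOn h (fun _ => w) (closedBall 0 1) :=
        Set.EqOn.of_subset_closure (s := ball 0 1) hw hc continuousOn_const
          ball_subset_closedBall hcl.ge
      have h2 := heq 1 (by simp)
      have h3 := hlt 0 (by simp)
      rw [h1 (by simp : (1 : ℂ) ∈ _)] at h2
      rw [h1 (by simp : (0 : ℂ) ∈ _)] at h3
      exact absurd h2 h3.ne
    · exact H _ subset_rfl isOpen_ball
  have hsub : ball (0 : ℂ) 1 ⊆ h '' ball 0 1 := by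
    refine (convex_ball (0 : ℂ) 1).isPreconnected.subset_of_closure_inter_subset hopen
      ⟨h 0, by simpa using hlt 0 (by simp), mem_image_of_mem _ (by simp)⟩ ?_
    rintro y ⟨hy, hy1⟩
    obtain ⟨z, hz, rfl⟩ := closure_minimal (image_mono ball_subset_closedBall) hcomp.isClosed hy
    refine mem_image_of_mem _ ?_
    by_contra hzb
    have : z ∈ sphere (0 : ℂ) 1 := by
      simp at hz hzb ⊢
      linarith
    simp [heq z this] at hy1
  exact hcl.ge.trans <| closure_minimal (hsub.trans (image_mono ball_subset_closedBall)) hcomp.isClosed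

theorem inner_deriv_eq_zero_of_orthogonal_frame {E : Type*} [NormedAddCommGroup E]
    [InnerProductSpace ℝ E] {U R T : ℝ → E} {R' T' : E} {t : ℝ}
    (hU : ∀ t, HasDerivAt U (T t) t) (hR : HasDerivAt R R' t) (hT : HasDerivAt T T' t)
    (hnorm : ∀ t, ‖U t‖ = 1) (hpar : ∀ t, ∃ c : ℝ, R t = c • U t)
    (hlen : ∀ t, ‖R t‖ = ‖T t‖) : ⟪R', T'⟫ = 0 := by
  have hUU : ∀ t, ⟪U t, U t⟫ = 1 := fun t => by rw [real_inner_self_eq_norm_sq, hnorm, one_pow]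
  have hUT : ∀ t, ⟪U t, T t⟫ = 0 := by
    intro t
    have h1 := (hU t).inner ℝ (hU t)
    have h2 : (fun t => ⟪U t, U t⟫) = fun _ => (1 : ℝ) := funext hUU
    rw [h2] at h1
    have := h1.unique (hasDerivAt_const t 1)
    rw [real_inner_comm (U t) (T t)] at this
    linarith
  set c : ℝ → ℝ := fun t => ⟪R t, U t⟫ with hcdef
  have hRc : ∀ t, R t = c t • U t := by
    intro t
    obtain ⟨a, ha⟩ := hpar t
    simp [hcdef, ha, real_inner_smul_left, hnorm]
  have hc : HasDerivAt c (⟪R t, T t⟫ + ⟪R', U t⟫) t := hR.inner ℝ (hU t)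
  set c' := ⟪R t, T t⟫ + ⟪R', U t⟫
  have hTT : ∀ t, ⟪T t, T t⟫ = c t * c t := by
    intro t
    rw [real_inner_self_eq_norm_sq, ← hlen, hRc t, norm_smul, hnorm, mul_one, Real.norm_eq_abs,
      sq_abs, sq]
  have hR' : R' = c t • T t + c' • U t :=
    hR.unique ((hc.smul (hU t)).congr_of_eventuallyEq (Filter.Eventually.of_forall hRc))
  have h1 : ⟪U t, T'⟫ + ⟪T t, T t⟫ = 0 := by
    have h := (hU t).inner ℝ hT
    rw [show (fun t => ⟪U t, T t⟫) = fun _ => (0 : ℝ) from funext hUT] at h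
    exact h.unique (hasDerivAt_const t 0)
  have h2 : ⟪T t, T'⟫ + ⟪T', T t⟫ = c' * c t + c t * c' := by
    have h := hT.inner ℝ hT
    rw [show (fun t => ⟪T t, T t⟫) = fun t => c t * c t from funext hTT] at h
    exact h.unique (hc.mul hc)
  rw [real_inner_comm (T t) T'] at h2
  rw [hR', inner_add_left, real_inner_smul_left, real_inner_smul_left]
  rw [hTT] at h1
  linear_combination c' * h1 + c t / 2 * h2

theorem uniqueDiffOn_unit_disk : UniqueDiffOn ℝ (closedBall (0 : ℂ) 1) :=
  uniqueDiffOn_convex (convex_closedBall _ _) (by simp [interior_closedBall])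

theorem fderivWithin_unit_disk_of_mem_ball {F : Type*} [NormedAddCommGroup F] [NormedSpace ℝ F]
    (f : ℂ → F) {z : ℂ} (hz : z ∈ ball (0 : ℂ) 1) :
    fderivWithin ℝ f (closedBall 0 1) z = fderiv ℝ f z :=
  fderivWithin_of_mem_nhds (Filter.mem_of_superset (isOpen_ball.mem_nhds hz) ball_subset_closedBall)

theorem fderivWithin_unit_disk_apply {f : ℂ → ℂ} (hf : ContDiffOn ℝ 1 f (closedBall 0 1))
    (hd : DifferentiableOn ℂ f (ball 0 1)) {z : ℂ} (hz : z ∈ closedBall (0 : ℂ) 1) (v : ℂ) :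
    fderivWithin ℝ f (closedBall 0 1) z v = v * fderivWithin ℝ f (closedBall 0 1) z 1 := by
  have hcont := hf.continuousOn_fderivWithin uniqueDiffOn_unit_disk le_rfl
  refine Set.EqOn.of_subset_closure (s := ball (0 : ℂ) 1)
    (f := fun z => fderivWithin ℝ f (closedBall 0 1) z v)
    (g := fun z => v * fderivWithin ℝ f (closedBall 0 1) z 1) ?_
    (hcont.clm_apply continuousOn_const)
    (continuousOn_const.mul (hcont.clm_apply continuousOn_const))
    ball_subset_closedBall (closure_ball 0 one_ne_zero).ge hz
  intro y hy
  have h2 := hd.differentiableAt (isOpen_ball.mem_nhds hy)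
  simp [fderivWithin_unit_disk_of_mem_ball f hy, h2.fderiv_restrictScalars ℝ]

/-- The components of `∂w/∂x - i ∂w/∂y` on the closed unit disk. -/
def complexGradient (w : ℂ → EuclideanSpace ℝ (Fin 3)) (j : Fin 3) (z : ℂ) : ℂ :=
  (fderivWithin ℝ w (closedBall 0 1) z 1 j : ℂ) -
    Complex.I * (fderivWithin ℝ w (closedBall 0 1) z Complex.I j : ℂ)

theorem complexGradient_mul (w : ℂ → EuclideanSpace ℝ (Fin 3)) (j : Fin 3) (z v : ℂ) :
    complexGradient w j z * v = (fderivWithin ℝ w (closedBall 0 1) z v j : ℂ) -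
      Complex.I * (fderivWithin ℝ w (closedBall 0 1) z (v * Complex.I) j : ℂ) := by
  have h1 : fderivWithin ℝ w (closedBall 0 1) z v =
      v.re • fderivWithin ℝ w (closedBall 0 1) z 1 +
      v.im • fderivWithin ℝ w (closedBall 0 1) z Complex.I := by
    rw [← map_smul, ← map_smul, ← map_add]
    congr 1
    apply Complex.ext <;> simp
  have h2 : fderivWithin ℝ w (closedBall 0 1) z (v * Complex.I) =
      (-v.im) • fderivWithin ℝ w (closedBall 0 1) z 1 +
      v.re • fderivWithin ℝ w (closedBall 0 1) z Complex.I := by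
    rw [← map_smul, ← map_smul, ← map_add]
    congr 1
    apply Complex.ext <;> simp
  rw [h1, h2, complexGradient]
  apply Complex.ext <;> simp <;> ring

theorem re_complexGradient_mul (w : ℂ → EuclideanSpace ℝ (Fin 3)) (j : Fin 3) (z v : ℂ) :
    (complexGradient w j z * v).re = fderivWithin ℝ w (closedBall 0 1) z v j := by
  simp [complexGradient_mul]

open scoped ContDiff in
theorem ContDiffOn.fderivWithin_unit_disk_apply {w : ℂ → EuclideanSpace ℝ (Fin 3)}
    (hw : ContDiffOn ℝ ∞ w (closedBall 0 1)) {v : ℂ → ℂ} (hv : ContDiff ℝ ∞ v) :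
    ContDiffOn ℝ ∞ (fun z => fderivWithin ℝ w (closedBall 0 1) z (v z)) (closedBall 0 1) :=
  (hw.fderivWithin uniqueDiffOn_unit_disk (m := ∞) (by simp)).clm_apply hv.contDiffOn

open scoped ContDiff in
theorem ContDiffOn.complexGradient {w : ℂ → EuclideanSpace ℝ (Fin 3)}
    (hw : ContDiffOn ℝ ∞ w (closedBall 0 1)) (j : Fin 3) :
    ContDiffOn ℝ ∞ (complexGradient w j) (closedBall 0 1) := by
  have h : ∀ v : ℂ, ContDiffOn ℝ ∞
      (fun z => (fderivWithin ℝ w (closedBall 0 1) z v j : ℂ)) (closedBall 0 1) := fun v =>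
    Complex.ofRealCLM.contDiff.comp_contDiffOn
      ((EuclideanSpace.proj (𝕜 := ℝ) j).contDiff.comp_contDiffOn
        (hw.fderivWithin_unit_disk_apply contDiff_const))
  exact (h 1).sub (contDiffOn_const.mul (h Complex.I))

theorem InnerProductSpace.HarmonicOnNhd.differentiableOn_complexGradient
    {w : ℂ → EuclideanSpace ℝ (Fin 3)}
    (hw : InnerProductSpace.HarmonicOnNhd w (ball 0 1)) (j : Fin 3) :
    DifferentiableOn ℂ (complexGradient w j) (ball 0 1) := by
  have hj := hw.comp_CLM (EuclideanSpace.proj (𝕜 := ℝ) j)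
  refine DifferentiableOn.congr (f := fun z =>
      (fderiv ℝ (EuclideanSpace.proj (𝕜 := ℝ) j ∘ w) z 1 : ℂ) -
      Complex.I * fderiv ℝ (EuclideanSpace.proj (𝕜 := ℝ) j ∘ w) z Complex.I) (fun z hz =>
    (HarmonicAt.differentiableAt_complex_partial (hj z hz)).differentiableWithinAt) ?_
  intro z hz
  have hd : DifferentiableAt ℝ w z := (hw z hz).1.differentiableAt two_ne_zero
  rw [complexGradient, fderivWithin_unit_disk_of_mem_ball w hz,
    ((EuclideanSpace.proj (𝕜 := ℝ) j).hasFDerivAt.comp z hd.hasFDerivAt).fderiv]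
  simp

open scoped ContDiff in
theorem sum_complexGradient_sq_eq_zero {w : ℂ → EuclideanSpace ℝ (Fin 3)}
    (hw : ContDiffOn ℝ ∞ w (closedBall 0 1))
    (hconf : ∀ z ∈ ball (0 : ℂ) 1, ⟪fderiv ℝ w z 1, fderiv ℝ w z Complex.I⟫ = 0 ∧
      ‖fderiv ℝ w z 1‖ = ‖fderiv ℝ w z Complex.I‖) {z : ℂ} (hz : z ∈ closedBall (0 : ℂ) 1) :
    ∑ j, complexGradient w j z ^ 2 = 0 := by
  refine Set.EqOn.of_subset_closure (s := ball (0 : ℂ) 1)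
    (f := fun z => ∑ j, complexGradient w j z ^ 2) (g := fun _ => 0) ?_
    (continuousOn_finsetSum _ fun j _ => ((hw.complexGradient j).continuousOn).pow 2)
    continuousOn_const ball_subset_closedBall (closure_ball 0 one_ne_zero).ge hz
  intro y hy
  obtain ⟨h1, h2⟩ := hconf y hy
  have h2 : ‖fderiv ℝ w y 1‖ ^ 2 = ‖fderiv ℝ w y Complex.I‖ ^ 2 := by rw [h2]
  rw [← fderivWithin_unit_disk_of_mem_ball w hy] at h1 h2
  rw [EuclideanSpace.real_norm_sq_eq, EuclideanSpace.real_norm_sq_eq] at h2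
  simp only [PiLp.inner_apply, Fin.sum_univ_three, RCLike.inner_apply, conj_trivial] at h1 h2
  simp only [Fin.sum_univ_three, complexGradient]
  apply Complex.ext
  · simp [sq]
    linarith
  · simp [sq]
    linarith

theorem ContDiffOn.continuousOn_fderivWithin_unit_disk_one {f : ℂ → ℂ}
    (hf : ContDiffOn ℝ 1 f (closedBall 0 1)) :
    ContinuousOn (fun z => fderivWithin ℝ f (closedBall 0 1) z 1) (closedBall 0 1) :=
  (hf.continuousOn_fderivWithin uniqueDiffOn_unit_disk le_rfl).clm_apply continuousOn_const

theorem fderivWithin_unit_disk_one_eq_deriv {f : ℂ → ℂ} (hf : DifferentiableOn ℂ f (ball 0 1))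
    {z : ℂ} (hz : z ∈ ball (0 : ℂ) 1) :
    fderivWithin ℝ f (closedBall 0 1) z 1 = deriv f z := by
  have h2 := hf.differentiableAt (isOpen_ball.mem_nhds hz)
  simp [fderivWithin_unit_disk_of_mem_ball f hz, h2.fderiv_restrictScalars ℝ]

theorem sum_mul_fderivWithin_eq_zero {f : Fin 3 → ℂ → ℂ}
    (hf : ∀ j, ContDiffOn ℝ 1 (f j) (closedBall 0 1))
    (hsq : ∀ z ∈ closedBall (0 : ℂ) 1, ∑ j, f j z ^ 2 = 0)
    {z : ℂ} (hz : z ∈ closedBall (0 : ℂ) 1) :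
    ∑ j, f j z * fderivWithin ℝ (f j) (closedBall 0 1) z 1 = 0 := by
  have h : HasFDerivWithinAt (fun z => ∑ j, f j z ^ 2)
      (∑ j, (2 * f j z) • fderivWithin ℝ (f j) (closedBall 0 1) z) (closedBall 0 1) z := by
    refine HasFDerivWithinAt.fun_sum fun j _ => ?_
    simpa using ((hf j).differentiableOn one_ne_zero z hz).hasFDerivWithinAt.pow 2
  have h0 : HasFDerivWithinAt (fun z => ∑ j, f j z ^ 2) (0 : ℂ →L[ℝ] ℂ) (closedBall 0 1) z :=
    (hasFDerivWithinAt_const (0 : ℂ) z _).congr hsq (hsq z hz)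
  have := DFunLike.congr_fun ((uniqueDiffOn_unit_disk z hz).eq h h0) (1 : ℂ)
  simp only [Fin.sum_univ_three, FunLike.coe_add, FunLike.coe_smul, Pi.add_apply,
    Pi.smul_apply, smul_eq_mul, FunLike.coe_zero, Pi.zero_apply] at this ⊢
  linear_combination this / 2

theorem ContDiffOn.hasDerivAt_comp_exp_mul_I {F : Type*} [NormedAddCommGroup F] [NormedSpace ℝ F]
    {f : ℂ → F} (hf : ContDiffOn ℝ 1 f (closedBall 0 1)) (t : ℝ) :
    HasDerivAt (fun t : ℝ => f (Complex.exp (t * Complex.I)))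
      (fderivWithin ℝ f (closedBall 0 1) (Complex.exp (t * Complex.I))
        (Complex.exp (t * Complex.I) * Complex.I)) t := by
  have hmem : ∀ t : ℝ, Complex.exp (t * Complex.I) ∈ closedBall (0 : ℂ) 1 := fun t => by
    simp [Complex.norm_exp_ofReal_mul_I]
  have hγ : HasDerivAt (fun t : ℝ => Complex.exp (t * Complex.I))
      (Complex.exp (t * Complex.I) * Complex.I) t := by
    simpa using ((hasDerivAt_id t).ofReal_comp.mul_const Complex.I).cexp
  exact ((hf.differentiableOn one_ne_zero _ (hmem t)).hasFDerivWithinAt).comp_hasDerivAt t hγ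
    (Filter.Eventually.of_forall hmem)

open scoped ContDiff in
/-- The square of the Hopf differential is real along the free boundary. -/
theorem im_hopf_sq_eq_zero {w : ℂ → EuclideanSpace ℝ (Fin 3)}
    (hw : ContDiffOn ℝ ∞ w (closedBall 0 1))
    (hd : ∀ j, DifferentiableOn ℂ (complexGradient w j) (ball 0 1))
    (hsq : ∀ z ∈ closedBall (0 : ℂ) 1, ∑ j, complexGradient w j z ^ 2 = 0)
    (hnorm : ∀ z ∈ sphere (0 : ℂ) 1, ‖w z‖ = 1)
    (hfree : ∀ z ∈ sphere (0 : ℂ) 1, ∃ c : ℝ, fderivWithin ℝ w (closedBall 0 1) z z = c • w z)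
    {z : ℂ} (hz : z ∈ sphere (0 : ℂ) 1) :
    (z ^ 4 * ∑ j, fderivWithin ℝ (complexGradient w j) (closedBall 0 1) z 1 ^ 2).im = 0 := by
  have hF : ∀ j, ContDiffOn ℝ 1 (complexGradient w j) (closedBall 0 1) := fun j =>
    (hw.complexGradient j).of_le (by simp)
  obtain ⟨t, rfl⟩ : ∃ t : ℝ, Complex.exp (t * Complex.I) = z := by
    refine ⟨z.arg, ?_⟩
    have := Complex.norm_mul_exp_arg_mul_I z
    rwa [mem_sphere_zero_iff_norm.1 hz, Complex.ofReal_one, one_mul] at this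
  have hs : ∀ t : ℝ, Complex.exp (t * Complex.I) ∈ sphere (0 : ℂ) 1 := fun t => by
    simp [Complex.norm_exp_ofReal_mul_I]
  have hk : ∀ t : ℝ, Complex.exp (t * Complex.I) ∈ closedBall (0 : ℂ) 1 := fun t =>
    sphere_subset_closedBall (hs t)
  set γ : ℝ → ℂ := fun t => Complex.exp (t * Complex.I) with hγ
  set R : ℝ → EuclideanSpace ℝ (Fin 3) := fun t =>
    fderivWithin ℝ w (closedBall 0 1) (γ t) (γ t) with hRdef
  set T : ℝ → EuclideanSpace ℝ (Fin 3) := fun t =>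
    fderivWithin ℝ w (closedBall 0 1) (γ t) (γ t * Complex.I) with hTdef
  obtain ⟨R', hR⟩ : ∃ R', HasDerivAt R R' t :=
    ⟨_, ((hw.fderivWithin_unit_disk_apply contDiff_id).of_le
      (by simp)).hasDerivAt_comp_exp_mul_I t⟩
  obtain ⟨T', hT⟩ : ∃ T', HasDerivAt T T' t :=
    ⟨_, ((hw.fderivWithin_unit_disk_apply (v := fun z => z * Complex.I)
      (contDiff_id.mul contDiff_const)).of_le (by simp)).hasDerivAt_comp_exp_mul_I t⟩
  have hRT : ∀ j s, complexGradient w j (γ s) * γ s = (R s j : ℂ) - Complex.I * (T s j : ℂ) :=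
    fun j s => complexGradient_mul w j (γ s) (γ s)
  have hlen : ∀ s, ‖R s‖ = ‖T s‖ := by
    intro s
    have h : ∑ j, (complexGradient w j (γ s) * γ s) ^ 2 = 0 := by
      simp only [mul_pow, ← Finset.sum_mul]
      rw [hsq (γ s) (hk s), zero_mul]
    simp only [hRT, Fin.sum_univ_three] at h
    have hre := congrArg Complex.re h
    simp [sq] at hre
    rw [← sq_eq_sq₀ (norm_nonneg _) (norm_nonneg _), EuclideanSpace.real_norm_sq_eq,
      EuclideanSpace.real_norm_sq_eq]
    simp only [Fin.sum_univ_three]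
    linarith
  have hin : ⟪R', T'⟫ = 0 := inner_deriv_eq_zero_of_orthogonal_frame
    (fun s => (hw.of_le (by simp)).hasDerivAt_comp_exp_mul_I s) hR hT
    (fun s => hnorm _ (hs s)) (fun s => hfree _ (hs s)) hlen
  have hderiv : ∀ j, Complex.I * (γ t * complexGradient w j (γ t) + γ t ^ 2 *
      fderivWithin ℝ (complexGradient w j) (closedBall 0 1) (γ t) 1) =
      (R' j : ℂ) - Complex.I * (T' j : ℂ) := by
    intro j
    have h1 : HasDerivAt (fun s => complexGradient w j (γ s) * γ s)
        ((R' j : ℂ) - Complex.I * (T' j : ℂ)) t := by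
      simp only [hRT]
      have hRj := ((EuclideanSpace.proj (𝕜 := ℝ) j).hasFDerivAt.comp_hasDerivAt t hR).ofReal_comp
      have hTj := ((EuclideanSpace.proj (𝕜 := ℝ) j).hasFDerivAt.comp_hasDerivAt t hT).ofReal_comp
      exact hRj.sub (hTj.const_mul Complex.I)
    have h2 := ((hF j).hasDerivAt_comp_exp_mul_I t).mul
      ((contDiffOn_id (𝕜 := ℝ) (n := 1) (s := closedBall (0 : ℂ) 1)).hasDerivAt_comp_exp_mul_I t)
    have h3 := h1.unique h2
    rw [fderivWithin_id (uniqueDiffOn_unit_disk _ (hk t)),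
      fderivWithin_unit_disk_apply (hF j) (hd j) (hk t)] at h3
    rw [h3]
    simp [hγ]
    ring
  have hcross := sum_mul_fderivWithin_eq_zero hF hsq (hk t)
  have hzero := hsq _ (hk t)
  have h0 := hderiv 0
  have h1 := hderiv 1
  have h2 := hderiv 2
  simp only [Fin.sum_univ_three] at hcross hzero ⊢
  simp only [PiLp.inner_apply, Fin.sum_univ_three, RCLike.inner_apply, conj_trivial] at hin
  have hG : ∀ {a b c a' b' c' g x y z : ℂ},
      Complex.I * (g * a + g ^ 2 * a') = x → Complex.I * (g * b + g ^ 2 * b') = y →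
      Complex.I * (g * c + g ^ 2 * c') = z → a ^ 2 + b ^ 2 + c ^ 2 = 0 →
      a * a' + b * b' + c * c' = 0 →
      g ^ 4 * (a' ^ 2 + b' ^ 2 + c' ^ 2) = - (x ^ 2 + y ^ 2 + z ^ 2) := by
    rintro a b c a' b' c' g x y z rfl rfl rfl h h'
    simp only [mul_pow, Complex.I_sq]
    linear_combination - g ^ 2 * h - 2 * g ^ 3 * h'
  rw [hG h0 h1 h2 hzero hcross]
  simp [sq]
  linarith

open scoped ContDiff in
theorem hopf_sq_eq_zero {w : ℂ → EuclideanSpace ℝ (Fin 3)}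
    (hw : ContDiffOn ℝ ∞ w (closedBall 0 1))
    (hd : ∀ j, DifferentiableOn ℂ (complexGradient w j) (ball 0 1))
    (hsq : ∀ z ∈ closedBall (0 : ℂ) 1, ∑ j, complexGradient w j z ^ 2 = 0)
    (hnorm : ∀ z ∈ sphere (0 : ℂ) 1, ‖w z‖ = 1)
    (hfree : ∀ z ∈ sphere (0 : ℂ) 1, ∃ c : ℝ, fderivWithin ℝ w (closedBall 0 1) z z = c • w z)
    {z : ℂ} (hz : z ∈ ball (0 : ℂ) 1) :
    ∑ j, deriv (complexGradient w j) z ^ 2 = 0 := by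
  have hF : ∀ j, ContDiffOn ℝ 1 (complexGradient w j) (closedBall 0 1) := fun j =>
    (hw.complexGradient j).of_le (by simp)
  have hG : ∀ z ∈ ball (0 : ℂ) 1, z ^ 4 * ∑ j, deriv (complexGradient w j) z ^ 2 = 0 := by
    intro z hz
    have hcongr : EqOn
        (fun z => z ^ 4 * ∑ j, fderivWithin ℝ (complexGradient w j) (closedBall 0 1) z 1 ^ 2)
        (fun z => z ^ 4 * ∑ j, deriv (complexGradient w j) z ^ 2) (ball 0 1) := by
      intro y hy
      simp only [fderivWithin_unit_disk_one_eq_deriv (hd _) hy]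
    have h := eq_of_im_eq_zero_on_sphere
      (G := fun z => z ^ 4 * ∑ j, fderivWithin ℝ (complexGradient w j) (closedBall 0 1) z 1 ^ 2)
      ((continuousOn_id.pow 4).mul (continuousOn_finsetSum _ fun j _ =>
        (hF j).continuousOn_fderivWithin_unit_disk_one.pow 2))
      (DifferentiableOn.congr ((differentiableOn_id.pow 4).mul (DifferentiableOn.fun_sum fun j _ =>
        ((hd j).deriv isOpen_ball).pow 2)) hcongr)
      (fun y hy => im_hopf_sq_eq_zero hw hd hsq hnorm hfree hy) hz
    refine (hcongr hz).symm.trans (h.trans ?_)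
    simp
  have hcont : ContinuousOn (fun z => ∑ j, deriv (complexGradient w j) z ^ 2) (ball (0 : ℂ) 1) :=
    continuousOn_finsetSum _ fun j _ => ((hd j).deriv isOpen_ball).continuousOn.pow 2
  refine Set.EqOn.of_subset_closure (s := ball (0 : ℂ) 1 \ {0})
    (f := fun z => ∑ j, deriv (complexGradient w j) z ^ 2) (g := fun _ => 0) ?_ hcont
    continuousOn_const sdiff_subset ?_ hz
  · rintro y ⟨hy, hy0⟩
    exact (mul_eq_zero.1 (hG y hy)).resolve_left (pow_ne_zero 4 hy0)
  · rw [sdiff_eq, inter_comm, inter_comm]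
    exact (dense_compl_singleton (0 : ℂ)).open_subset_closure_inter isOpen_ball

theorem finrank_span_pair_of_orthonormal {a b : EuclideanSpace ℝ (Fin 3)} (ha : ‖a‖ = 1)
    (hb : ‖b‖ = 1) (hab : ⟪a, b⟫ = 0) : Module.finrank ℝ (Submodule.span ℝ {a, b}) = 2 := by
  have ho : Orthonormal ℝ ![a, b] := by
    rw [orthonormal_iff_ite]
    intro i j
    fin_cases i <;> fin_cases j <;> simp [ha, hb, hab, real_inner_comm a b]
  have := finrank_span_eq_card ho.linearIndependent
  rwa [Matrix.range_cons_cons_empty, Fintype.card_fin] at this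

theorem eq_and_norm_planar_coordinate {a b x : EuclideanSpace ℝ (Fin 3)} (ha : ‖a‖ = 1)
    (hb : ‖b‖ = 1) (hab : ⟪a, b⟫ = 0) (hx : x ∈ Submodule.span ℝ {a, b}) :
    x = (⟪a, x⟫ : ℝ) • a + (⟪b, x⟫ : ℝ) • b ∧
      ‖(⟪a, x⟫ : ℂ) + (⟪b, x⟫ : ℂ) * Complex.I‖ = ‖x‖ := by
  obtain ⟨s, t, rfl⟩ := Submodule.mem_span_pair.1 hx
  have hba : ⟪b, a⟫ = 0 := by rw [real_inner_comm, hab]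
  have h1 : ⟪a, s • a + t • b⟫ = s := by
    simp [inner_add_right, real_inner_smul_right, ha, hab]
  have h2 : ⟪b, s • a + t • b⟫ = t := by
    simp [inner_add_right, real_inner_smul_right, hb, hba]
  rw [h1, h2]
  refine ⟨rfl, ?_⟩
  rw [← sq_eq_sq₀ (norm_nonneg _) (norm_nonneg _), ← Complex.normSq_eq_norm_sq,
    Complex.normSq_add_mul_I, ← real_inner_self_eq_norm_sq, inner_add_left,
    real_inner_smul_left, real_inner_smul_left, h1, h2]
  ring

open scoped ContDiff in
theorem fderiv_eq_of_hopf_sq_eq_zero {w : ℂ → EuclideanSpace ℝ (Fin 3)}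
    (hw : ContDiffOn ℝ ∞ w (closedBall 0 1))
    (hd : ∀ j, DifferentiableOn ℂ (complexGradient w j) (ball 0 1))
    (hsq : ∀ z ∈ closedBall (0 : ℂ) 1, ∑ j, complexGradient w j z ^ 2 = 0)
    (hhopf : ∀ z ∈ ball (0 : ℂ) 1, ∑ j, deriv (complexGradient w j) z ^ 2 = 0)
    (h0 : fderivWithin ℝ w (closedBall 0 1) 0 1 ≠ 0) :
    ∃ f : ℂ → ℂ, ∀ z ∈ ball (0 : ℂ) 1, ∀ v, fderivWithin ℝ w (closedBall 0 1) z v =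
      (f z * v).re • fderivWithin ℝ w (closedBall 0 1) 0 1 +
      (f z * v).im • fderivWithin ℝ w (closedBall 0 1) 0 Complex.I := by
  obtain ⟨k, hk⟩ : ∃ k, fderivWithin ℝ w (closedBall 0 1) 0 1 k ≠ 0 := by
    by_contra! h
    exact h0 (by ext k; simpa using h k)
  have hFk : complexGradient w k 0 ≠ 0 := by
    intro h
    apply hk
    rw [← re_complexGradient_mul, h]
    simp
  refine ⟨fun z => complexGradient w k z / complexGradient w k 0, fun z hz v => ?_⟩
  ext j
  have hcross : ∀ y ∈ ball (0 : ℂ) 1,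
      ∑ j, complexGradient w j y * deriv (complexGradient w j) y = 0 := by
    intro y hy
    have := sum_mul_fderivWithin_eq_zero (fun j => (hw.complexGradient j).of_le (by simp)) hsq
      (ball_subset_closedBall hy)
    simpa only [fderivWithin_unit_disk_one_eq_deriv (hd _) hy] using this
  have hprop := mul_eq_mul_of_wronskian_eq_zero (hd k) (hd j)
    (fun y hy => minor_eq_zero_of_isotropic (hsq y (ball_subset_closedBall hy)) (hcross y hy)
      (hhopf y hy) k j) hFk hz
  have hFj : complexGradient w j z * v =
      complexGradient w k z / complexGradient w k 0 * v * complexGradient w j 0 := by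
    field_simp
    linear_combination v * hprop
  rw [← re_complexGradient_mul, hFj]
  generalize complexGradient w k z / complexGradient w k 0 * v = g
  simp [complexGradient]

open scoped ContDiff in
theorem exists_plane_image_eq {w : ℂ → EuclideanSpace ℝ (Fin 3)}
    (hw : ContDiffOn ℝ ∞ w (closedBall 0 1))
    (hinj : ∀ z ∈ closedBall (0 : ℂ) 1,
      Function.Injective (fderivWithin ℝ w (closedBall 0 1) z))
    (hconf : ∀ z ∈ ball (0 : ℂ) 1, ⟪fderiv ℝ w z 1, fderiv ℝ w z Complex.I⟫ = 0 ∧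
      ‖fderiv ℝ w z 1‖ = ‖fderiv ℝ w z Complex.I‖)
    (hharm : InnerProductSpace.HarmonicOnNhd w (ball 0 1))
    (hlt : ∀ z ∈ ball (0 : ℂ) 1, ‖w z‖ < 1)
    (hnorm : ∀ z ∈ sphere (0 : ℂ) 1, ‖w z‖ = 1)
    (hfree : ∀ z ∈ sphere (0 : ℂ) 1, ∃ c : ℝ, fderivWithin ℝ w (closedBall 0 1) z z = c • w z) :
    ∃ P : Submodule ℝ (EuclideanSpace ℝ (Fin 3)), Module.finrank ℝ P = 2 ∧
      w '' closedBall 0 1 = closedBall 0 1 ∩ (P : Set (EuclideanSpace ℝ (Fin 3))) := by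
  have hne : ∀ z ∈ closedBall (0 : ℂ) 1, fderivWithin ℝ w (closedBall 0 1) z 1 ≠ 0 :=
    fun z hz h => one_ne_zero (hinj z hz (h.trans (map_zero _).symm))
  have hd := fun j => hharm.differentiableOn_complexGradient j
  have hsq := fun z (hz : z ∈ closedBall (0 : ℂ) 1) => sum_complexGradient_sq_eq_zero hw hconf hz
  obtain ⟨f, hf⟩ := fderiv_eq_of_hopf_sq_eq_zero hw hd hsq
    (fun z hz => hopf_sq_eq_zero hw hd hsq hnorm hfree hz) (hne 0 (by simp))
  obtain ⟨hαβ, hlen⟩ := hconf 0 (by simp)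
  have h0 := hne 0 (by simp)
  rw [← fderivWithin_unit_disk_of_mem_ball w (by simp)] at hαβ hlen
  set α := fderivWithin ℝ w (closedBall 0 1) 0 1
  set β := fderivWithin ℝ w (closedBall 0 1) 0 Complex.I
  have hr : ‖α‖ ≠ 0 := norm_ne_zero_iff.2 h0
  obtain ⟨a, hαa⟩ : ∃ a, a = ‖α‖⁻¹ • α := ⟨_, rfl⟩
  obtain ⟨b, hβb⟩ : ∃ b, b = ‖α‖⁻¹ • β := ⟨_, rfl⟩
  have ha : ‖a‖ = 1 := by rw [hαa, norm_smul, norm_inv, norm_norm, inv_mul_cancel₀ hr]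
  have hb : ‖b‖ = 1 := by rw [hβb, norm_smul, norm_inv, norm_norm, ← hlen, inv_mul_cancel₀ hr]
  have hab : ⟪a, b⟫ = 0 := by
    rw [hαa, hβb, real_inner_smul_left, real_inner_smul_right, hαβ, mul_zero, mul_zero]
  have hba : ⟪b, a⟫ = 0 := by rw [real_inner_comm, hab]
  replace hαa : α = ‖α‖ • a := by rw [hαa, smul_inv_smul₀ hr]
  replace hβb : β = ‖α‖ • b := by rw [hβb, smul_inv_smul₀ hr]
  have hD : ∀ z ∈ ball (0 : ℂ) 1, ∀ v, fderivWithin ℝ w (closedBall 0 1) z v =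
      (‖α‖ * (f z * v).re) • a + (‖α‖ * (f z * v).im) • b := by
    intro z hz v
    rw [hf z hz v, mul_comm ‖α‖, mul_comm ‖α‖, mul_smul, mul_smul, ← hαa, ← hβb]
  have hdw : DifferentiableOn ℝ w (closedBall 0 1) := hw.differentiableOn (by simp)
  have hmem : ∀ z ∈ closedBall (0 : ℂ) 1, w z ∈ Submodule.span ℝ {a, b} := by
    intro z hz
    rw [← Submodule.orthogonal_orthogonal (Submodule.span ℝ {a, b}), Submodule.mem_orthogonal]
    intro n hn
    have hna : ⟪n, a⟫ = 0 := Submodule.inner_left_of_mem_orthogonal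
      (Submodule.subset_span (by simp)) hn
    have hnb : ⟪n, b⟫ = 0 := Submodule.inner_left_of_mem_orthogonal
      (Submodule.subset_span (by simp)) hn
    have hnD : ∀ v, ∀ z ∈ closedBall (0 : ℂ) 1,
        ⟪n, fderivWithin ℝ w (closedBall 0 1) z v⟫ = 0 := by
      intro v z hz
      refine Set.EqOn.of_subset_closure (s := ball (0 : ℂ) 1)
        (f := fun z => ⟪n, fderivWithin ℝ w (closedBall 0 1) z v⟫) (g := fun _ => 0) ?_
        (continuousOn_const.inner (𝕜 := ℝ)
          (hw.fderivWithin_unit_disk_apply contDiff_const).continuousOn)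
        continuousOn_const ball_subset_closedBall (closure_ball 0 one_ne_zero).ge hz
      intro y hy
      simp [hD y hy v, inner_add_right, real_inner_smul_right, hna, hnb]
    have hconst : ⟪n, w z⟫ = ⟪n, w 1⟫ := by
      refine (convex_closedBall (0 : ℂ) 1).is_const_of_fderivWithin_eq_zero (𝕜 := ℝ)
        (f := fun z => ⟪n, w z⟫) ((differentiableOn_const n).inner ℝ hdw) (fun y hy => ?_) hz
        (by simp)
      have := ((innerSL ℝ n).hasFDerivAt.comp_hasFDerivWithinAt y
        (hdw y hy).hasFDerivWithinAt).fderivWithin (uniqueDiffOn_unit_disk y hy)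
      refine Eq.trans this ?_
      ext1 v
      simpa using hnD v y hy
    rw [hconst]
    obtain ⟨c, hc⟩ := hfree 1 (by simp)
    have h1 := hnD 1 1 (by simp)
    rw [hc, real_inner_smul_right] at h1
    refine (mul_eq_zero.1 h1).resolve_left ?_
    rintro rfl
    exact hne 1 (by simp) (by simpa using hc)
  obtain ⟨h, hh⟩ : ∃ h : ℂ → ℂ, h = fun z => (⟪a, w z⟫ : ℂ) + (⟪b, w z⟫ : ℂ) * Complex.I :=
    ⟨_, rfl⟩
  have hhn : ∀ z ∈ closedBall (0 : ℂ) 1, ‖h z‖ = ‖w z‖ := fun z hz => by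
    rw [hh]
    exact (eq_and_norm_planar_coordinate ha hb hab (hmem z hz)).2
  have hcoord : ∀ n : EuclideanSpace ℝ (Fin 3), ContinuousOn (fun z => (⟪n, w z⟫ : ℂ))
      (closedBall 0 1) := fun n =>
    Complex.continuous_ofReal.comp_continuousOn
      (continuousOn_const.inner (𝕜 := ℝ) hw.continuousOn)
  have hhc : ContinuousOn h (closedBall 0 1) := by
    rw [hh]
    exact (hcoord a).add ((hcoord b).mul continuousOn_const)
  have hhd : DifferentiableOn ℂ h (ball 0 1) := by
    intro z hz
    have hwz : HasFDerivAt w (fderivWithin ℝ w (closedBall 0 1) z) z := by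
      rw [fderivWithin_unit_disk_of_mem_ball w hz]
      exact ((hharm z hz).1.differentiableAt two_ne_zero).hasFDerivAt
    have hn : ∀ n : EuclideanSpace ℝ (Fin 3), HasFDerivAt (fun z => (⟪n, w z⟫ : ℂ))
        (Complex.ofRealCLM.comp ((innerSL ℝ n).comp (fderivWithin ℝ w (closedBall 0 1) z))) z :=
      fun n => Complex.ofRealCLM.hasFDerivAt.comp z ((innerSL ℝ n).hasFDerivAt.comp z hwz)
    have hder := (hn a).add ((hn b).mul_const Complex.I)
    rw [hh]
    refine (differentiableAt_complex_iff_differentiableAt_real.2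
      ⟨hder.differentiableAt, ?_⟩).differentiableWithinAt
    rw [hder.fderiv]
    apply Complex.ext <;>
    simp [hD z hz, inner_add_right, real_inner_smul_right, ha, hb, hab, hba]
  refine ⟨Submodule.span ℝ {a, b}, finrank_span_pair_of_orthonormal ha hb hab, ?_⟩
  have hsurj := closedBall_subset_image_of_proper hhc hhd
    (fun z hz => (hhn z (ball_subset_closedBall hz)).trans_lt (hlt z hz))
    (fun z hz => (hhn z (sphere_subset_closedBall hz)).trans (hnorm z hz))
  apply Subset.antisymm
  · rintro _ ⟨z, hz, rfl⟩
    refine ⟨?_, hmem z hz⟩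
    rw [mem_closedBall_zero_iff]
    rcases (mem_closedBall_zero_iff.1 hz).lt_or_eq with h1 | h1
    · exact (hlt z (mem_ball_zero_iff.2 h1)).le
    · exact (hnorm z (mem_sphere_zero_iff_norm.2 h1)).le
  · rintro y ⟨hy, hyP⟩
    obtain ⟨hy1, hy2⟩ := eq_and_norm_planar_coordinate ha hb hab hyP
    obtain ⟨z, hz, hzy⟩ := hsurj
      (mem_closedBall_zero_iff.2 (hy2.trans_le (mem_closedBall_zero_iff.1 hy)))
    refine ⟨z, hz, ?_⟩
    rw [hh] at hzy
    have hre := congrArg Complex.re hzy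
    have him := congrArg Complex.im hzy
    simp at hre him
    rw [(eq_and_norm_planar_coordinate ha hb hab (hmem z hz)).1, hre, him, ← hy1]

/-- **Nitsche's theorem**: a free boundary immersed minimal disk in the unit
ball `B³` is a flat equatorial disk. -/
theorem nitsche_free_boundary_minimal_disk
    (u : EuclideanSpace ℝ (Fin 2) → EuclideanSpace ℝ (Fin 3))
    -- smooth up to the boundary on the closed unit disk
    (hsm : ContDiffOn ℝ (⊤ : ℕ∞) u (closedBall 0 1))
    -- `u` is an immersion
    (himm : ∀ x ∈ closedBall (0 : EuclideanSpace ℝ (Fin 2)) 1,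
      Function.Injective (fderivWithin ℝ u (closedBall 0 1) x))
    -- conformal parametrization
    (hconf : ∀ x ∈ ball (0 : EuclideanSpace ℝ (Fin 2)) 1,
      ⟪fderiv ℝ u x (EuclideanSpace.single 0 1),
        fderiv ℝ u x (EuclideanSpace.single 1 1)⟫ = 0 ∧
      ‖fderiv ℝ u x (EuclideanSpace.single 0 1)‖ =
        ‖fderiv ℝ u x (EuclideanSpace.single 1 1)‖)
    -- harmonicity: together with conformality this says that `u` is a
    -- (conformally parametrized) minimal surface, i.e. has vanishing mean curvature
    (hharm : ∀ x ∈ ball (0 : EuclideanSpace ℝ (Fin 2)) 1,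
      iteratedFDeriv ℝ 2 u x ![EuclideanSpace.single 0 1, EuclideanSpace.single 0 1] +
        iteratedFDeriv ℝ 2 u x ![EuclideanSpace.single 1 1, EuclideanSpace.single 1 1] = 0)
    -- the disk lies in the closed unit ball
    (hball : ∀ x ∈ closedBall (0 : EuclideanSpace ℝ (Fin 2)) 1,
      u x ∈ closedBall (0 : EuclideanSpace ℝ (Fin 3)) 1)
    -- the boundary of the disk, and only the boundary, lies on `∂B³`
    (hbdry : ∀ x ∈ closedBall (0 : EuclideanSpace ℝ (Fin 2)) 1,
      (u x ∈ sphere (0 : EuclideanSpace ℝ (Fin 3)) 1 ↔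
        x ∈ sphere (0 : EuclideanSpace ℝ (Fin 2)) 1))
    -- free boundary condition: along `∂D²` the outward normal derivative of `u`
    -- is parallel to the position vector, i.e. Σ meets `∂B³` orthogonally
    (hfree : ∀ x ∈ sphere (0 : EuclideanSpace ℝ (Fin 2)) 1,
      ∃ c : ℝ, fderivWithin ℝ u (closedBall 0 1) x x = c • u x) :
    -- conclusion: the image is a totally geodesic equatorial disk through `0`
    ∃ P : Submodule ℝ (EuclideanSpace ℝ (Fin 3)),
      Module.finrank ℝ P = 2 ∧
      u '' closedBall 0 1 = closedBall 0 1 ∩ (P : Set (EuclideanSpace ℝ (Fin 3))) := by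
  set e := Complex.orthonormalBasisOneI.repr with he
  have he1 : e 1 = EuclideanSpace.single 0 1 := by
    ext i
    fin_cases i <;> simp [he, Complex.orthonormalBasisOneI_repr_apply]
  have heI : e Complex.I = EuclideanSpace.single 1 1 := by
    ext i
    fin_cases i <;> simp [he, Complex.orthonormalBasisOneI_repr_apply]
  have hpre : e ⁻¹' closedBall 0 1 = closedBall 0 1 := by
    rw [e.preimage_closedBall, map_zero]
  have hK : ∀ z ∈ closedBall (0 : ℂ) 1, e z ∈ closedBall (0 : EuclideanSpace ℝ (Fin 2)) 1 :=
    fun z hz => by simpa using hz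
  have hB : ∀ z ∈ ball (0 : ℂ) 1, e z ∈ ball (0 : EuclideanSpace ℝ (Fin 2)) 1 :=
    fun z hz => by simpa using hz
  have hS : ∀ z ∈ sphere (0 : ℂ) 1, e z ∈ sphere (0 : EuclideanSpace ℝ (Fin 2)) 1 :=
    fun z hz => by simpa using hz
  have hw : ContDiffOn ℝ (⊤ : ℕ∞) (u ∘ e) (closedBall 0 1) :=
    hsm.comp e.toContinuousLinearEquiv.contDiff.contDiffOn hK
  have hDw : ∀ z ∈ closedBall (0 : ℂ) 1, ∀ v, fderivWithin ℝ (u ∘ e) (closedBall 0 1) z v =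
      fderivWithin ℝ u (closedBall 0 1) (e z) (e v) := by
    intro z hz v
    have := e.toContinuousLinearEquiv.comp_right_fderivWithin (f := u) (s := closedBall 0 1) (x := z)
      (by
        change UniqueDiffWithinAt ℝ (e ⁻¹' closedBall 0 1) z
        rw [hpre]
        exact uniqueDiffOn_unit_disk z hz)
    change fderivWithin ℝ (u ∘ e) (e ⁻¹' closedBall 0 1) z = _ at this
    rw [hpre] at this
    exact DFunLike.congr_fun this v
  have hDw' : ∀ z v, fderiv ℝ (u ∘ e) z v = fderiv ℝ u (e z) (e v) := fun z v =>
    DFunLike.congr_fun (e.toContinuousLinearEquiv.comp_right_fderiv (f := u) (x := z)) v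
  have hΔ : ∀ z ∈ ball (0 : ℂ) 1, Laplacian.laplacian (u ∘ e) z = 0 := by
    intro z hz
    have h2 := e.toContinuousLinearEquiv.iteratedFDerivWithin_comp_right u uniqueDiffOn_univ
      (mem_univ (e.toContinuousLinearEquiv z)) 2
    rw [preimage_univ, iteratedFDerivWithin_univ, iteratedFDerivWithin_univ] at h2
    have h3 : ∀ v : ℂ, iteratedFDeriv ℝ 2 (u ∘ e) z ![v, v] =
        iteratedFDeriv ℝ 2 u (e z) ![e v, e v] := by
      intro v
      refine (DFunLike.congr_fun h2 ![v, v]).trans ?_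
      rw [ContinuousMultilinearMap.compContinuousLinearMap_apply]
      refine congrArg (iteratedFDeriv ℝ 2 u (e z)) (funext fun i => ?_)
      fin_cases i <;> rfl
    rw [InnerProductSpace.laplacian_eq_iteratedFDeriv_complexPlane]
    simp only [h3, he1, heI]
    exact hharm (e z) (hB z hz)
  have hnorm : ∀ z ∈ sphere (0 : ℂ) 1, ‖(u ∘ e) z‖ = 1 := fun z hz =>
    mem_sphere_zero_iff_norm.1
      ((hbdry (e z) (hK z (sphere_subset_closedBall hz))).2 (hS z hz))
  have hlt : ∀ z ∈ ball (0 : ℂ) 1, ‖(u ∘ e) z‖ < 1 := by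
    intro z hz
    have hz' := hK z (ball_subset_closedBall hz)
    refine lt_of_le_of_ne (mem_closedBall_zero_iff.1 (hball (e z) hz')) fun h => ?_
    have h1 := mem_sphere_zero_iff_norm.1 ((hbdry (e z) hz').1 (mem_sphere_zero_iff_norm.2 h))
    have h2 := mem_ball_zero_iff.1 (hB z hz)
    exact h2.ne h1
  obtain ⟨P, hP, himage⟩ := exists_plane_image_eq (w := u ∘ e) hw
    (fun z hz v v' h => by
      rw [hDw z hz, hDw z hz] at h
      exact e.injective (himm (e z) (hK z hz) h))
    (fun z hz => by
      rw [hDw', hDw', he1, heI]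
      exact hconf (e z) (hB z hz))
    (fun z hz => ⟨(hw.contDiffAt (Filter.mem_of_superset (isOpen_ball.mem_nhds hz)
      ball_subset_closedBall)).of_le (WithTop.coe_le_coe.2 (le_top : (2 : ℕ∞) ≤ ⊤)),
      Filter.eventually_of_mem (isOpen_ball.mem_nhds hz) hΔ⟩)
    hlt hnorm
    (fun z hz => by
      rw [hDw z (sphere_subset_closedBall hz)]
      exact hfree (e z) (hS z hz))
  refine ⟨P, hP, ?_⟩
  rw [← himage, image_comp, ← hpre, image_preimage_eq _ e.surjective]
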